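/- For all n_1,…,n_p ∈ ℕ, the number of acyclic orientations of the labelled complete multipartite graph K_{n_1,…,n_p} equals Σ_{k_1=0}^{n_1} ⋯ Σ_{k_p=0}^{n_p} k_1!·k_2!⋯k_p! · S(n_1,k_1)·S(n_2,k_2)⋯S(n_p,k_p) · X_{k_1,…,k_p}. -/

import Mathlib

/-- The Stirling numbers of the second kind `S(r, s)`: the number of partitions of
an `r`-element set into `s` nonempty blocks, via the standard recurrence
`S(r+1, s+1) = (s+1)·S(r, s+1) + S(r, s)`. -/
def stirling2 : ℕ → ℕ → ℕ
  | 0, 0 => 1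
  | 0, _ + 1 => 0
  | _ + 1, 0 => 0
  | r + 1, s + 1 => (s + 1) * stirling2 r (s + 1) + stirling2 r s

/-- `smirnovCount k` is the number of Smirnov words over the alphabet `Fin p`
with exactly `k i` occurrences of each letter `i`, i.e. words in which no two
consecutive letters are equal. -/
noncomputable def smirnovCount {p : ℕ} (k : Fin p → ℕ) : ℕ :=
  Nat.card {w : List (Fin p) //
    List.Chain' (· ≠ ·) w ∧ ∀ i : Fin p, w.count i = k i}

open Classical in
theorem card_surj_aux (n : ℕ) : ∀ (α : Type) [Finite α],
    Nat.card {g : Fin n → α // Function.Surjective g} =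
      (Nat.card α).factorial * stirling2 n (Nat.card α) := by
  induction n with
  | zero =>
    intro α _
    rcases isEmpty_or_nonempty α with h | h
    · have : Nat.card α = 0 := by simp
      rw [this]
      have : Unique {g : Fin 0 → α // Function.Surjective g} :=
        ⟨⟨⟨Fin.elim0, fun a => h.elim a⟩⟩, fun a => Subtype.ext (funext fun i => i.elim0)⟩
      simp [stirling2]
    · obtain ⟨k, hk⟩ : ∃ k, Nat.card α = k + 1 :=
        ⟨Nat.card α - 1, by have := Nat.card_pos (α := α); omega⟩
      rw [hk]
      have : IsEmpty {g : Fin 0 → α // Function.Surjective g} :=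
        ⟨fun g => by obtain ⟨i, _⟩ := g.2 (Classical.arbitrary α); exact i.elim0⟩
      simp [stirling2]
  | succ n ih =>
    intro α _
    have := Fintype.ofFinite α
    let e : {g : Fin (n+1) → α // Function.Surjective g} ≃
        Σ a : α, {h : Fin n → α // ∀ x, x ≠ a → ∃ i, h i = x} :=
      { toFun := fun g => ⟨g.1 0, fun i => g.1 i.succ, fun x hx => by
          obtain ⟨i, hi⟩ := g.2 x
          rcases Fin.eq_zero_or_eq_succ i with h | ⟨j, h⟩
          · subst h; exact absurd hi.symm hx
          · subst h; exact ⟨j, hi⟩⟩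
        invFun := fun s => ⟨Fin.cons s.1 s.2.1, fun x => by
          by_cases hx : x = s.1
          · exact ⟨0, by simp [hx]⟩
          · obtain ⟨i, hi⟩ := s.2.2 x hx
            exact ⟨i.succ, by simpa using hi⟩⟩
        left_inv := fun g => by
          apply Subtype.ext; funext i
          refine Fin.cases ?_ (fun j => ?_) i <;> simp
        right_inv := fun s => by
          rcases s with ⟨a, h, hh⟩
          rfl }
    have key : ∀ a : α, Nat.card {h : Fin n → α // ∀ x, x ≠ a → ∃ i, h i = x} =
        Nat.card {g : Fin n → α // Function.Surjective g} +
        Nat.card {g : Fin n → {x // x ≠ a} // Function.Surjective g} := by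
      intro a
      rw [← Nat.card_sum]
      symm
      refine Nat.card_congr (Equiv.ofBijective (fun s => Sum.elim
        (fun g => (⟨g.1, fun x _ => g.2 x⟩ : {h : Fin n → α // ∀ x, x ≠ a → ∃ i, h i = x}))
        (fun g => ⟨fun i => (g.1 i).1, fun x hx => by
          obtain ⟨i, hi⟩ := g.2 ⟨x, hx⟩
          exact ⟨i, congrArg Subtype.val hi⟩⟩) s) ⟨?_, ?_⟩)
      · rintro (⟨g, hg⟩ | ⟨g, hg⟩) (⟨g', hg'⟩ | ⟨g', hg'⟩) h
        · simpa using h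
        · exfalso
          simp only [Sum.elim_inl, Sum.elim_inr, Subtype.mk.injEq] at h
          obtain ⟨i, hi⟩ := hg a
          rw [h] at hi
          exact (g' i).2 hi
        · exfalso
          simp only [Sum.elim_inl, Sum.elim_inr, Subtype.mk.injEq] at h
          obtain ⟨i, hi⟩ := hg' a
          rw [← h] at hi
          exact (g i).2 hi
        · simp only [Sum.elim_inr, Subtype.mk.injEq] at h
          have : g = g' := funext fun i => Subtype.ext (congrFun h i)
          subst this; rfl
      · rintro ⟨h, hh⟩
        by_cases hs : ∃ i, h i = a
        · refine ⟨Sum.inl ⟨h, fun x => ?_⟩, rfl⟩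
          by_cases hx : x = a
          · rw [hx]; exact hs
          · exact hh x hx
        · push Not at hs
          refine ⟨Sum.inr ⟨fun i => ⟨h i, hs i⟩, fun x => ?_⟩, rfl⟩
          obtain ⟨i, hi⟩ := hh x.1 x.2
          exact ⟨i, Subtype.ext hi⟩
    rw [Nat.card_congr e, Nat.card_sigma]
    have h2 : ∀ a : α, Nat.card {x // x ≠ a} = Nat.card α - 1 := by
      intro a
      simp [Nat.card_eq_fintype_card, Fintype.card_subtype_compl]
    simp only [key, ih, h2, Finset.sum_const, Finset.card_univ, ← Nat.card_eq_fintype_card]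
    rcases hc : Nat.card α with _ | k
    · simp [stirling2]
    · simp only [stirling2, Nat.factorial_succ, Nat.add_sub_cancel, smul_eq_mul]
      ring

theorem card_positions {β : Type} [DecidableEq β] (i : β) (w : List β) :
    Finite {j : ℕ // w[j]? = some i} ∧ Nat.card {j : ℕ // w[j]? = some i} = w.count i := by
  induction w with
  | nil => 
    have : IsEmpty {j : ℕ // ([] : List β)[j]? = some i} := ⟨fun j => by simpa using j.2⟩
    exact ⟨inferInstance, by simp⟩
  | cons a w ih =>
    obtain ⟨hf, hc⟩ := ih
    let e : {j : ℕ // (a :: w)[j]? = some i} ≃ PLift (a = i) ⊕ {j : ℕ // w[j]? = some i} :=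
      { toFun := fun j => match j with
          | ⟨0, h⟩ => Sum.inl ⟨by simpa using h⟩
          | ⟨j+1, h⟩ => Sum.inr ⟨j, by simpa using h⟩
        invFun := fun s => match s with
          | Sum.inl h => ⟨0, by simpa using h.down⟩
          | Sum.inr j => ⟨j.1 + 1, by simpa using j.2⟩
        left_inv := by rintro ⟨_ | j, h⟩ <;> rfl
        right_inv := by rintro (h | j) <;> rfl }
    have : Finite (PLift (a = i)) := inferInstance
    refine ⟨Finite.of_equiv _ e.symm, ?_⟩
    rw [Nat.card_congr e, Nat.card_sum, hc, List.count_cons]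
    by_cases h : a = i
    · have : Unique (PLift (a = i)) := ⟨⟨⟨h⟩⟩, fun _ => rfl⟩
      simp [h]; omega
    · have : IsEmpty (PLift (a = i)) := ⟨fun x => h x.down⟩
      simp [h]

/-- Level functions compatible with a word. -/
def LevelFn {p : ℕ} (n : Fin p → ℕ) (w : List (Fin p)) : Type :=
  {f : (Σ i : Fin p, Fin (n i)) → ℕ //
    (∀ v, w[f v]? = some v.1) ∧ ∀ j < w.length, ∃ v, f v = j}

def levelEquiv {p : ℕ} (n : Fin p → ℕ) (w : List (Fin p)) :
    LevelFn n w ≃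
      ∀ i, {g : Fin (n i) → {j : ℕ // w[j]? = some i} // Function.Surjective g} where
  toFun f i := ⟨fun a => ⟨f.1 ⟨i, a⟩, f.2.1 ⟨i, a⟩⟩, fun j => by
    obtain ⟨⟨i', a⟩, hv⟩ := f.2.2 j.1 (List.getElem?_eq_some_iff.1 j.2).1
    have h1 := f.2.1 ⟨i', a⟩
    rw [hv, j.2] at h1
    obtain rfl : i = i' := by simpa using h1
    exact ⟨a, Subtype.ext hv⟩⟩
  invFun g := ⟨fun v => ((g v.1).1 v.2).1, fun v => ((g v.1).1 v.2).2, fun j hj => by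
    obtain ⟨a, ha⟩ := (g w[j]).2 ⟨j, by simp [hj]⟩
    exact ⟨⟨w[j], a⟩, by simp [ha]⟩⟩
  left_inv f := rfl
  right_inv g := rfl

theorem card_levelFn {p : ℕ} (n : Fin p → ℕ) (w : List (Fin p)) :
    Nat.card (LevelFn n w) = ∏ i, (w.count i).factorial * stirling2 (n i) (w.count i) := by
  rw [Nat.card_congr (levelEquiv n w), Nat.card_pi]
  refine Finset.prod_congr rfl fun i _ => ?_
  have := (card_positions i w).1
  rw [card_surj_aux, (card_positions i w).2]

theorem finite_levelFn {p : ℕ} (n : Fin p → ℕ) (w : List (Fin p)) : Finite (LevelFn n w) := by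
  have := fun i => (card_positions i w).1
  exact Finite.of_equiv _ (levelEquiv n w).symm

theorem count_le_of_levelFn {p : ℕ} (n : Fin p → ℕ) (w : List (Fin p)) (f : LevelFn n w)
    (i : Fin p) : w.count i ≤ n i := by
  rw [← (card_positions i w).2]
  simpa using Nat.card_le_card_of_surjective _ (levelEquiv n w f i).2

abbrev SWord {p : ℕ} (k : Fin p → ℕ) : Type :=
  {w : List (Fin p) // List.Chain' (· ≠ ·) w ∧ ∀ i : Fin p, w.count i = k i}

theorem finite_sword {p : ℕ} (k : Fin p → ℕ) : Finite (SWord k) := by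
  have h := List.finite_length_eq (Fin p) (∑ i, k i)
  refine (Set.Finite.subset h (t := {w : List (Fin p) | List.Chain' (· ≠ ·) w ∧ ∀ i, w.count i = k i})
    ?_).to_subtype
  rintro w ⟨_, hw⟩
  have := List.sum_toFinset_count_eq_length w
  show w.length = _
  rw [← this]
  simp_rw [← hw]
  refine Finset.sum_subset (Finset.subset_univ _) fun i _ hi => ?_
  simpa [List.count_eq_zero] using hi

abbrev AcOr {p : ℕ} (n : Fin p → ℕ) : Type :=
  {o : (Σ i : Fin p, Fin (n i)) → (Σ i : Fin p, Fin (n i)) → Prop //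
        (∀ u v, o u v → u.1 ≠ v.1) ∧
        (∀ u v, u.1 ≠ v.1 → Xor' (o u v) (o v u)) ∧
        Irreflexive (Relation.TransGen o)}

def toOr {p : ℕ} (n : Fin p → ℕ)
    (s : Σ w : {w : List (Fin p) // List.Chain' (· ≠ ·) w}, LevelFn n w.1) : AcOr n :=
  ⟨fun u v => s.2.1 u < s.2.1 v ∧ u.1 ≠ v.1, fun u v h => h.2, fun u v h => by
    have hne : s.2.1 u ≠ s.2.1 v := fun h' => by
      have h1 := s.2.2.1 u
      rw [h', s.2.2.1 v] at h1
      exact h (by simpa using h1.symm)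
    rcases lt_or_gt_of_ne hne with h1 | h1
    · exact Or.inl ⟨⟨h1, h⟩, fun h2 => absurd h2.1 (by omega)⟩
    · exact Or.inr ⟨⟨h1, h.symm⟩, fun h2 => absurd h2.1 (by omega)⟩, by
    have : ∀ u v, Relation.TransGen (fun u v => s.2.1 u < s.2.1 v ∧ u.1 ≠ v.1) u v →
        s.2.1 u < s.2.1 v := by
      intro u v h
      induction h with
      | single h => exact h.1
      | tail _ h ih => exact ih.trans h.1
    intro u hu
    exact lt_irrefl _ (this u u hu)⟩

/-- A predecessor on the previous level. -/
theorem exists_pred {p : ℕ} (n : Fin p → ℕ) (w : List (Fin p)) (hw : List.Chain' (· ≠ ·) w)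
    (f : LevelFn n w) (v) (k : ℕ) (hv : f.1 v = k + 1) :
    ∃ u, f.1 u = k ∧ u.1 ≠ v.1 := by
  have h1 := f.2.1 v
  rw [hv] at h1
  obtain ⟨hl, hg⟩ := List.getElem?_eq_some_iff.1 h1
  obtain ⟨u, hu⟩ := f.2.2 k (by omega)
  refine ⟨u, hu, ?_⟩
  have h2 := f.2.1 u
  rw [hu] at h2
  obtain ⟨hl2, hg2⟩ := List.getElem?_eq_some_iff.1 h2
  have := List.isChain_iff_getElem.1 hw k hl
  rwa [hg, hg2] at this

theorem level_le {p : ℕ} (n : Fin p → ℕ)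
    (s t : Σ w : {w : List (Fin p) // List.Chain' (· ≠ ·) w}, LevelFn n w.1)
    (h : toOr n s = toOr n t) : ∀ (k : ℕ) v, s.2.1 v = k → k ≤ t.2.1 v := by
  intro k
  induction k with
  | zero => intros; omega
  | succ k ih =>
    intro v hv
    obtain ⟨u, hu, huv⟩ := exists_pred n _ s.1.2 s.2 v k hv
    have h1 := ih u hu
    have h2 : (toOr n s).1 u v := ⟨by omega, huv⟩
    rw [h] at h2
    have := h2.1
    omega

theorem toOr_bijective {p : ℕ} (n : Fin p → ℕ) : Function.Bijective (toOr n) := by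
  constructor
  · intro s t h
    have hf : s.2.1 = t.2.1 := funext fun v =>
      le_antisymm (level_le n s t h _ v rfl) (level_le n t s h.symm _ v rfl)
    obtain ⟨⟨w, hw⟩, ⟨f, hf1, hf2⟩⟩ := s
    obtain ⟨⟨w', hw'⟩, ⟨f', hf1', hf2'⟩⟩ := t
    simp only at hf hf1 hf2 hf1' hf2'
    subst hf
    have hww : w = w' := by
      apply List.ext_getElem?
      intro j
      by_cases hj : ∃ v, f v = j
      · obtain ⟨v, rfl⟩ := hj
        rw [hf1, hf1']
      · have h1 : w.length ≤ j := by
          by_contra hc; exact hj (hf2 j (by omega))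
        have h2 : w'.length ≤ j := by
          by_contra hc; exact hj (hf2' j (by omega))
        rw [List.getElem?_eq_none h1, List.getElem?_eq_none h2]
    subst hww
    rfl
  · rintro ⟨o, ho1, ho2, ho3⟩
    classical
    have hwf : WellFounded (Relation.TransGen o) := by
      have : IsIrrefl _ (Relation.TransGen o) := ⟨ho3⟩
      exact Finite.wellFounded_of_trans_of_irrefl _
    have hwf' : WellFounded o := Subrelation.wf (fun h => Relation.TransGen.single h) hwf
    obtain ⟨f, hf⟩ : ∃ f : (Σ i : Fin p, Fin (n i)) → ℕ,
        ∀ v, f v = (Finset.univ.filter (fun u => o u v)).sup (fun u => f u + 1) := by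
      let F : ∀ v, (∀ u, o u v → ℕ) → ℕ := fun v g =>
        Finset.univ.sup (fun u => if h : o u v then g u h + 1 else 0)
      refine ⟨hwf'.fix F, fun v => ?_⟩
      rw [hwf'.fix_eq]
      apply le_antisymm
      · refine Finset.sup_le fun u _ => ?_
        split_ifs with h
        · exact Finset.le_sup (f := fun u => hwf'.fix F u + 1) (by simp [h])
        · exact Nat.zero_le _
      · refine Finset.sup_le fun u hu => ?_
        have hu' : o u v := by simpa using hu
        have := Finset.le_sup (f := fun u => if h : o u v then hwf'.fix F u + 1 else 0)
          (Finset.mem_univ u)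
        refine le_trans (le_of_eq ?_) this
        simp [hu']
    have hlt : ∀ u v, o u v → f u < f v := fun u v h => by
      rw [hf v]
      exact Finset.le_sup (f := fun u => f u + 1) (by simp [h])
    have hpred : ∀ v k, f v = k + 1 → ∃ u, o u v ∧ f u = k := by
      intro v k hv
      have hne : (Finset.univ.filter (fun u => o u v)).Nonempty := by
        by_contra hc
        rw [Finset.not_nonempty_iff_eq_empty] at hc
        have := hf v
        rw [hc] at this
        simp at this; omega
      obtain ⟨u, hu, hu2⟩ := Finset.exists_mem_eq_sup _ hne (fun u => f u + 1)
      rw [← hf v, hv] at hu2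
      exact ⟨u, by simpa using hu, by omega⟩
    have hsame : ∀ u v, f u = f v → u.1 = v.1 := by
      intro u v h
      by_contra hc
      rcases ho2 u v hc with h1 | h1
      · have := hlt _ _ h1.1; omega
      · have := hlt _ _ h1.1; omega
    let m := Finset.univ.sup (fun v => f v + 1)
    have hm : ∀ v, f v < m := fun v => Finset.le_sup (f := fun u => f u + 1) (Finset.mem_univ v)
    have hdown : ∀ d k, (∃ v, f v = k + d) → ∃ v, f v = k := by
      intro d
      induction d with
      | zero => intro k h; exact h
      | succ d ih =>
        rintro k ⟨v, hv⟩
        obtain ⟨u, _, hu⟩ := hpred v (k + d) hv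
        exact ih k ⟨u, hu⟩
    have hsurj : ∀ j < m, ∃ v, f v = j := by
      intro j hj
      obtain ⟨v, _, hv⟩ := (Finset.lt_sup_iff).1 hj
      exact hdown (f v - j) j ⟨v, by omega⟩
    choose r hr using fun j : Fin m => hsurj j.1 j.2
    let w : List (Fin p) := List.ofFn (fun j => (r j).1)
    have hwl : w.length = m := by simp [w]
    have hwget : ∀ j (hj : j < m), w[j]? = some (r ⟨j, hj⟩).1 := by
      intro j hj
      simp [w, hj]
    have hw : List.Chain' (· ≠ ·) w := by
      apply List.isChain_iff_getElem.2
      intro j hj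
      have hj' : j + 1 < m := by omega
      simp only [w, List.getElem_ofFn]
      obtain ⟨u, hu, huj⟩ := hpred (r ⟨j+1, hj'⟩) j (hr _)
      have := hsame (r ⟨j, by omega⟩) u (by rw [hr, huj])
      rw [this]
      exact ho1 _ _ hu
    refine ⟨⟨⟨w, hw⟩, ⟨f, fun v => ?_, fun j hj => hsurj j (by rwa [hwl] at hj)⟩⟩, ?_⟩
    · rw [hwget _ (hm v)]
      exact congrArg some (hsame _ _ (hr _))
    · apply Subtype.ext
      funext u v
      apply propext
      constructor
      · rintro ⟨h1, h2⟩
        rcases ho2 u v h2 with h | h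
        · exact h.1
        · have := hlt _ _ h.1
          simp only at h1
          omega
      · intro h
        exact ⟨hlt _ _ h, ho1 _ _ h⟩

/-- Grouping the words by their letter counts. -/
def groupEquiv {p : ℕ} (n : Fin p → ℕ) :
    (Σ w : {w : List (Fin p) // List.Chain' (· ≠ ·) w}, LevelFn n w.1) ≃
    Σ k : {k // k ∈ Fintype.piFinset (fun i : Fin p => Finset.range (n i + 1))},
      Σ w : SWord k.1, LevelFn n w.1 where
  toFun s := ⟨⟨fun i => s.1.1.count i, by
    simp only [Fintype.mem_piFinset, Finset.mem_range]
    intro i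
    have := count_le_of_levelFn n _ s.2 i
    omega⟩, ⟨⟨s.1.1, s.1.2, fun _ => rfl⟩, s.2⟩⟩
  invFun t := ⟨⟨t.2.1.1, t.2.1.2.1⟩, t.2.2⟩
  left_inv s := rfl
  right_inv t := by
    obtain ⟨⟨k, hk⟩, ⟨w, hw, hc⟩, f⟩ := t
    obtain rfl : (fun i => w.count i) = k := funext hc
    rfl

theorem card_acyclicOrientations_completeMultipartite (p : ℕ) (n : Fin p → ℕ) :
    Nat.card {o : (Σ i : Fin p, Fin (n i)) → (Σ i : Fin p, Fin (n i)) → Prop //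
        (∀ u v, o u v → u.1 ≠ v.1) ∧
        (∀ u v, u.1 ≠ v.1 → Xor' (o u v) (o v u)) ∧
        Irreflexive (Relation.TransGen o)} =
    ∑ k ∈ Fintype.piFinset (fun i : Fin p => Finset.range (n i + 1)),
      (∏ i : Fin p, (k i).factorial * stirling2 (n i) (k i)) * smirnovCount k := by
  have hfin := fun w : List (Fin p) => finite_levelFn n w
  have hfin2 := fun k : Fin p → ℕ => finite_sword k
  rw [← Nat.card_congr (Equiv.ofBijective _ (toOr_bijective n)),
    Nat.card_congr (groupEquiv n), Nat.card_sigma]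
  rw [← Finset.sum_coe_sort (Fintype.piFinset (fun i : Fin p => Finset.range (n i + 1)))
    (fun k => (∏ i : Fin p, (k i).factorial * stirling2 (n i) (k i)) * smirnovCount k)]
  refine Finset.sum_congr rfl fun k _ => ?_
  have := Fintype.ofFinite (SWord k.1)
  rw [Nat.card_sigma]
  rw [Finset.sum_congr rfl (g := fun _ => ∏ i : Fin p, (k.1 i).factorial * stirling2 (n i) (k.1 i))
    (fun w _ => by rw [card_levelFn]; simp only [w.2.2])]
  rw [Finset.sum_const, Finset.card_univ, ← Nat.card_eq_fintype_card, smul_eq_mul, mul_comm]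
  rfl
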